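/- arXiv:2406.04757 — 3 statements merged into one kernel-verified Lean document; each statement's English description precedes it below -/
import Mathlib

section
/- Assume 1 ≤ k < q. Then the projective Reed-Muller code C_{n,k}^q has length N = (q^{n+1}-1)/(q-1), dimension (as an 𝔽_q-vector space) equal to the binomial coefficient C(n+k, k), and minimum distance equal to (q-k+1)·q^{n-1}. -/
open scoped BigOperators

/-- A vector in `F^(n+1)` is a standard representative if its leftmost nonzero
coordinate equals `1`. -/
def IsStdRep {F : Type*} [Field F] {n : ℕ} (v : Fin (n + 1) → F) : Prop :=
  ∃ i, (∀ j, j < i → v j = 0) ∧ v i = 1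

/-- The set of standard affine representatives of the points of projective n-space. -/
abbrev ProjPts (F : Type*) [Field F] (n : ℕ) : Type _ :=
  {v : Fin (n + 1) → F // IsStdRep v}

noncomputable instance {F : Type*} [Field F] [Fintype F] {n : ℕ} :
    Fintype (ProjPts F n) := Fintype.ofFinite _

/-- Evaluation of a polynomial at the standard representatives, as a linear map. -/
noncomputable def evalOnPts (F : Type*) [Field F] [Fintype F] (n : ℕ) :
    MvPolynomial (Fin (n + 1)) F →ₗ[F] (ProjPts F n → F) where
  toFun f := fun p => MvPolynomial.eval p.1 f
  map_add' f g := by ext p; simp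
  map_smul' c f := by ext p; simp [MvPolynomial.smul_eval]

/-- The projective Reed–Muller code `C_{n,k}^q`: evaluations of homogeneous degree-`k`
polynomials at the standard representatives of the points of `ℙ^n(F)`. -/
noncomputable def PRM (F : Type*) [Field F] [Fintype F] (n k : ℕ) :
    Submodule F (ProjPts F n → F) :=
  Submodule.map (evalOnPts F n) (MvPolynomial.homogeneousSubmodule (Fin (n + 1)) F k)

/-- The dual code with respect to the standard bilinear form. -/
noncomputable def dualCode {F : Type*} [Field F] [Fintype F] {n : ℕ}
    (C : Submodule F (ProjPts F n → F)) : Submodule F (ProjPts F n → F) where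
  carrier := {y | ∀ c ∈ C, ∑ p : ProjPts F n, y p * c p = 0}
  zero_mem' := by intro c hc; simp
  add_mem' := by
    intro a b ha hb c hc
    show ∑ p : ProjPts F n, (a + b) p * c p = 0
    simp only [Pi.add_apply, add_mul, Finset.sum_add_distrib, ha c hc, hb c hc, add_zero]
  smul_mem' := by
    intro r a ha c hc
    show ∑ p : ProjPts F n, (r • a) p * c p = 0
    simp only [Pi.smul_apply, smul_eq_mul, mul_assoc, ← Finset.mul_sum, ha c hc, mul_zero]

open MvPolynomial in
theorem MvPolynomial.IsHomogeneous.eval_smul {σ R : Type*} [CommSemiring R]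
    {f : MvPolynomial σ R} {k : ℕ} (hf : f.IsHomogeneous k) (t : R) (v : σ → R) :
    eval (t • v) f = t ^ k * eval v f := by
  rw [eval_eq, eval_eq, Finset.mul_sum]
  refine Finset.sum_congr rfl fun d hd => ?_
  have h : ∑ i ∈ d.support, d i = k := by
    simp [← hf (mem_support_iff.mp hd), Finsupp.weight_apply, Finsupp.sum]
  simp only [Pi.smul_apply, smul_eq_mul, mul_pow, Finset.prod_mul_distrib,
    Finset.prod_pow_eq_pow_sum, h]
  ring

open MvPolynomial in
theorem MvPolynomial.totalDegree_aeval_le_of_le_one {σ τ R : Type*} [CommSemiring R]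
    (g : σ → MvPolynomial τ R) (hg : ∀ i, (g i).totalDegree ≤ 1) (p : MvPolynomial σ R) :
    (aeval g p).totalDegree ≤ p.totalDegree := by
  rw [aeval_eq_eval₂Hom, coe_eval₂Hom, eval₂_eq]
  refine totalDegree_finsetSum_le fun d hd => (totalDegree_mul _ _).trans ?_
  rw [algebraMap_eq, totalDegree_C, zero_add]
  refine (totalDegree_finsetProd _ _).trans (le_trans ?_ (le_totalDegree hd))
  refine Finset.sum_le_sum fun i _ => (totalDegree_pow _ _).trans ?_
  exact (Nat.mul_le_mul_left _ (hg i)).trans_eq (mul_one _)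

open MvPolynomial in
theorem MvPolynomial.finrank_homogeneousSubmodule (F : Type*) [Field F] (n k : ℕ) :
    Module.finrank F (homogeneousSubmodule (Fin (n + 1)) F k) = (n + k).choose k := by
  classical
  rw [homogeneousSubmodule_eq_finsupp_supported,
    (AddMonoidAlgebra.supportedEquivFinsupp (R := F) (S := F) _).finrank_eq]
  have hs : {d : Fin (n + 1) →₀ ℕ | d.degree = k} =
      ↑(Finset.finsuppAntidiag (Finset.univ : Finset (Fin (n + 1))) k) := by
    ext d
    simp [Finsupp.degree_eq_sum]
  rw [hs, Module.finrank_finsupp_self]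
  simp [Finset.card_finsuppAntidiag_nat_eq_multichoose, Nat.multichoose_eq]

/-- The number of points of affine space at which `f` does not vanish. -/
noncomputable def nonzeroCount {F : Type*} [Field F] [Fintype F] {n : ℕ}
    (f : MvPolynomial (Fin n) F) : ℕ :=
  Nat.card {v : Fin n → F // MvPolynomial.eval v f ≠ 0}

open MvPolynomial in
theorem le_nonzeroCount {F : Type*} [Field F] [Fintype F] {n d : ℕ}
    {f : MvPolynomial (Fin n) F} (hf : f ≠ 0) (hd : f.totalDegree ≤ d) :
    (Fintype.card F - d) * Fintype.card F ^ n ≤ Fintype.card F * nonzeroCount f := by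
  classical
  have h := schwartz_zippel_totalDegree hf (Finset.univ : Finset F)
  rw [Fintype.piFinset_univ, Finset.card_univ] at h
  have hq : 0 < Fintype.card F := Fintype.card_pos
  rw [div_le_div_iff₀ (by positivity) (by positivity)] at h
  norm_cast at h
  have hc : nonzeroCount f + (Finset.univ.filter fun v : Fin n → F => eval v f = 0).card =
      Fintype.card F ^ n := by
    rw [nonzeroCount, Nat.card_eq_fintype_card, Fintype.card_subtype, add_comm,
      Finset.card_filter_add_card_filter_not]
    simp
  have h2 := h.trans (Nat.mul_le_mul_right _ hd)
  rw [Nat.sub_mul, ← hc] at *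
  rw [tsub_le_iff_left]
  nlinarith


theorem nonzeroCount_eq_sum {F : Type*} [Field F] [Fintype F] {m : ℕ}
    (f : MvPolynomial (Fin (m + 1)) F) (l : (Fin m → F) → F) :
    nonzeroCount f = ∑ t : F, Nat.card
      {y : Fin m → F // MvPolynomial.eval (Fin.cons (t + l y) y : Fin (m + 1) → F) f ≠ 0} := by
  rw [← Nat.card_sigma]
  refine Nat.card_congr ⟨fun v => ⟨v.1 0 - l (Fin.tail v.1), Fin.tail v.1, ?_⟩,
    fun x => ⟨Fin.cons (x.1 + l x.2.1) x.2.1, x.2.2⟩, ?_, ?_⟩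
  · simpa using v.2
  · intro v
    simp
  · rintro ⟨t, y, hy⟩
    refine Sigma.ext (by simp) ?_
    simp only [Fin.tail_cons]
    congr! 2
    simp

/-- The linear form with coefficients `c`. -/
noncomputable def linForm {F : Type*} [Field F] {m : ℕ} (c : Fin m → F) :
    MvPolynomial (Fin m) F := ∑ j, MvPolynomial.C (c j) * MvPolynomial.X j

open MvPolynomial in
theorem isHomogeneous_linForm {F : Type*} [Field F] {m : ℕ} (c : Fin m → F) :
    (linForm c).IsHomogeneous 1 :=
  IsHomogeneous.sum _ _ _ fun j _ => by
    simpa using (isHomogeneous_C _ (c j)).mul (isHomogeneous_X _ j)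

open MvPolynomial in
theorem eval_linForm {F : Type*} [Field F] {m : ℕ} (c y : Fin m → F) :
    eval y (linForm c) = c ⬝ᵥ y := by
  simp [linForm, dotProduct]

open MvPolynomial in
theorem eval_aeval_cons {F : Type*} [Field F] {m : ℕ} (f : MvPolynomial (Fin (m + 1)) F)
    (p : MvPolynomial (Fin m) F) (y : Fin m → F) :
    eval y (aeval (Fin.cons p X : Fin (m + 1) → MvPolynomial (Fin m) F) f) =
      eval (Fin.cons (eval y p) y : Fin (m + 1) → F) f := by
  rw [← coe_aeval_eq_eval, ← coe_aeval_eq_eval, RingHom.coe_coe, ← AlgHom.comp_apply,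
    RingHom.coe_coe]
  refine AlgHom.congr_fun (algHom_ext fun i => ?_) f
  refine Fin.cases ?_ (fun j => ?_) i <;> simp

open MvPolynomial in
theorem exists_eq_mul_of_aeval_cons_eq_zero {F : Type*} [Field F] {m : ℕ}
    {f : MvPolynomial (Fin (m + 1)) F} {c : Fin m → F}
    (hf : aeval (Fin.cons (linForm c) X : Fin (m + 1) → MvPolynomial (Fin m) F) f = 0) :
    ∃ h, f = (X 0 - rename Fin.succ (linForm c)) * h := by
  have key : Polynomial.eval (linForm c) (finSuccEquiv F m f) = 0 := by
    rw [← hf]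
    have : ((Polynomial.aeval (R := MvPolynomial (Fin m) F) (linForm c)).restrictScalars F).comp
        (finSuccEquiv F m : _ →ₐ[F] _) = aeval (Fin.cons (linForm c) X) := by
      refine algHom_ext fun i => ?_
      refine Fin.cases ?_ (fun j => ?_) i
      · simp [finSuccEquiv_X_zero]
      · simp [finSuccEquiv_X_succ]
    simpa using AlgHom.congr_fun this f
  obtain ⟨h, hh⟩ := Polynomial.dvd_iff_isRoot.mpr key
  refine ⟨(finSuccEquiv F m).symm h, (finSuccEquiv F m).injective ?_⟩
  rw [hh, map_mul, AlgEquiv.apply_symm_apply]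
  have hC (a : F) : finSuccEquiv F m (C a) = Polynomial.C (C a) := by simp [finSuccEquiv_apply]
  simp [linForm, finSuccEquiv_X_zero, finSuccEquiv_X_succ, hC]

open MvPolynomial in
theorem le_nonzeroCount_of_aeval_cons_eq_zero {F : Type*} [Field F] [Fintype F] {m k : ℕ}
    {f : MvPolynomial (Fin (m + 1)) F} (hf : f.IsHomogeneous k) (hf0 : f ≠ 0)
    (hk1 : 1 ≤ k) (hk : k ≤ Fintype.card F) {c : Fin m → F}
    (hc : aeval (Fin.cons (linForm c) X : Fin (m + 1) → MvPolynomial (Fin m) F) f = 0) :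
    (Fintype.card F - 1) * (Fintype.card F - k + 1) * Fintype.card F ^ m ≤
      Fintype.card F * nonzeroCount f := by
  classical
  obtain ⟨h, rfl⟩ := exists_eq_mul_of_aeval_cons_eq_zero hc
  set g : MvPolynomial (Fin (m + 1)) F := X 0 - rename Fin.succ (linForm c) with hg
  have hg0 : g ≠ 0 := left_ne_zero_of_mul hf0
  have hh0 : h ≠ 0 := right_ne_zero_of_mul hf0
  have hgd : g.totalDegree = 1 :=
    ((isHomogeneous_X _ _).sub (isHomogeneous_linForm c).rename_isHomogeneous).totalDegree hg0
  have hd : h.totalDegree ≤ k - 1 := by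
    have := hf.totalDegree hf0
    rw [totalDegree_mul_of_isDomain hg0 hh0] at this
    omega
  have hgv (v : Fin (m + 1) → F) : eval v g = v 0 - c ⬝ᵥ Fin.tail v := by
    simp [hg, eval_rename, eval_linForm]
    rfl
  obtain ⟨v, hv⟩ : ∃ v, eval v (g * h) ≠ 0 := by
    by_contra! H
    exact hf0 (hf.eq_zero_of_forall_eval_eq_zero_of_le_card H (by simpa using hk))
  have ht0 : eval v g ≠ 0 := by
    rw [map_mul] at hv
    exact left_ne_zero_of_mul hv
  have hslice (t : F) (ht : t ≠ 0) : (Fintype.card F - k + 1) * Fintype.card F ^ m ≤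
      Fintype.card F * Nat.card
        {y : Fin m → F // eval (Fin.cons (t + c ⬝ᵥ y) y : Fin (m + 1) → F) (g * h) ≠ 0} := by
    set p := aeval (Fin.cons (C t + linForm c) X : Fin (m + 1) → MvPolynomial (Fin m) F) h with hp
    have hpe (y : Fin m → F) : eval y p = eval (Fin.cons (t + c ⬝ᵥ y) y : Fin (m + 1) → F) h := by
      rw [hp, eval_aeval_cons, map_add, eval_C, eval_linForm]
    have hpd : p.totalDegree ≤ k - 1 := by
      refine (totalDegree_aeval_le_of_le_one _ (fun i => ?_) h).trans hd
      refine Fin.cases ?_ (fun j => ?_) i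
      · refine (totalDegree_add _ _).trans ?_
        simpa using (isHomogeneous_linForm c).totalDegree_le
      · simp
    have hp0 : p ≠ 0 := by
      intro hp0
      set s := t / eval v g with hs
      have hs0 : s ≠ 0 := div_ne_zero ht ht0
      have h1 : (Fin.cons (t + c ⬝ᵥ (s • Fin.tail v)) (s • Fin.tail v) : Fin (m + 1) → F) =
          s • v := by
        have : t = s * eval v g := by rw [hs]; field_simp
        refine funext fun i => Fin.cases ?_ (fun j => ?_) i
        · simp only [Fin.cons_zero, dotProduct_smul, Pi.smul_apply, smul_eq_mul]
          rw [this, hgv]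
          ring
        · simp [Fin.tail]
      have h2 := hpe (s • Fin.tail v)
      rw [hp0, map_zero, h1] at h2
      have h3 := hf.eval_smul s v
      rw [map_mul, ← h2, mul_zero] at h3
      exact mul_ne_zero (pow_ne_zero k hs0) hv h3.symm
    have h4 := le_nonzeroCount hp0 hpd
    have h5 : nonzeroCount p = Nat.card
        {y : Fin m → F // eval (Fin.cons (t + c ⬝ᵥ y) y : Fin (m + 1) → F) (g * h) ≠ 0} := by
      refine Nat.card_congr (Equiv.subtypeEquivRight fun y => ?_)
      rw [map_mul, hgv, ← hpe]
      simp [ht]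
    rwa [h5, show Fintype.card F - (k - 1) = Fintype.card F - k + 1 by omega] at h4
  rw [nonzeroCount_eq_sum _ (fun y => c ⬝ᵥ y), Finset.mul_sum]
  calc _ = ∑ t ∈ (Finset.univ : Finset F).erase 0,
        (Fintype.card F - k + 1) * Fintype.card F ^ m := by
        simp [mul_assoc, Finset.card_erase_of_mem]
    _ ≤ _ := Finset.sum_le_sum fun t ht => hslice t (Finset.ne_of_mem_erase ht)
    _ ≤ _ := Finset.sum_le_sum_of_subset (Finset.erase_subset _ _)

open MvPolynomial in
theorem sum_nonzeroCount_le {F : Type*} [Field F] [Fintype F] {m : ℕ}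
    {f : MvPolynomial (Fin (m + 1)) F} (hf : eval 0 f = 0) :
    Fintype.card F * ∑ c : Fin m → F,
      nonzeroCount (aeval (Fin.cons (linForm c) X : Fin (m + 1) → MvPolynomial (Fin m) F) f) ≤
      Fintype.card F ^ m * nonzeroCount f := by
  classical
  have hdual (y : Fin m → F) (hy : y ≠ 0) : ∃ e, e ⬝ᵥ y = 1 := by
    obtain ⟨i, hi⟩ := Function.ne_iff.mp hy
    exact ⟨Pi.single i (y i)⁻¹, by simpa using inv_mul_cancel₀ hi⟩
  choose! e he using hdual
  have hy0 {c y : Fin m → F}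
      (h : eval (Fin.cons (c ⬝ᵥ y) y : Fin (m + 1) → F) f ≠ 0) : y ≠ 0 := by
    rintro rfl
    refine h ?_
    have h0 : (Fin.cons (c ⬝ᵥ 0) 0 : Fin (m + 1) → F) = 0 := by
      refine _root_.funext fun i => ?_
      refine Fin.cases ?_ (fun j => ?_) i <;> simp
    rw [h0, hf]
  have heval (c y : Fin m → F) :
      eval y (aeval (Fin.cons (linForm c) X : Fin (m + 1) → MvPolynomial (Fin m) F) f) =
        eval (Fin.cons (c ⬝ᵥ y) y : Fin (m + 1) → F) f := by
    rw [eval_aeval_cons, eval_linForm]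
  simp only [nonzeroCount, heval]
  rw [← Nat.card_sigma, ← Nat.card_eq_fintype_card, ← Nat.card_prod,
    show Nat.card F ^ m = Nat.card (Fin m → F) by simp, ← Nat.card_prod]
  refine Nat.card_le_card_of_injective
    (fun x => (x.2.1 + x.1 • e x.2.2.1, ⟨Fin.cons (x.2.1 ⬝ᵥ x.2.2.1) x.2.2.1, x.2.2.2⟩)) ?_
  rintro ⟨s, c, y, h⟩ ⟨s', c', y', h'⟩ H
  simp only [Prod.mk.injEq, Subtype.mk.injEq, Fin.cons_inj] at H
  obtain ⟨H1, H2, rfl⟩ := H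
  have H3 := congrArg (· ⬝ᵥ y) H1
  simp only [add_dotProduct, smul_dotProduct, he y (hy0 h), H2, smul_eq_mul, mul_one,
    add_right_inj] at H3
  subst H3
  obtain rfl := add_right_cancel H1
  rfl

open MvPolynomial in
/-- A nonzero form of degree `k` in `n + 1` variables, with `1 ≤ k ≤ q`, is nonzero at no fewer
than `(q - 1) (q - k + 1) q ^ (n - 1)` vectors. -/
theorem le_nonzeroCount_of_isHomogeneous {F : Type*} [Field F] [Fintype F] {k : ℕ}
    (hk1 : 1 ≤ k) (hk : k ≤ Fintype.card F) : ∀ {n : ℕ} {f : MvPolynomial (Fin (n + 1)) F},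
    f.IsHomogeneous k → f ≠ 0 →
    (Fintype.card F - 1) * (Fintype.card F - k + 1) * Fintype.card F ^ n ≤
      Fintype.card F * nonzeroCount f := by
  intro n
  induction n with
  | zero =>
    intro f hf hf0
    obtain ⟨v, hv⟩ : ∃ v, eval v f ≠ 0 := by
      by_contra! H
      exact hf0 (hf.eq_zero_of_forall_eval_eq_zero_of_le_card H (by simpa using hk))
    have h1 : Nat.card Fˣ ≤ nonzeroCount f := by
      refine Nat.card_le_card_of_injective
        (fun t : Fˣ => ⟨(t : F) • v, by
          rw [hf.eval_smul]; exact mul_ne_zero (pow_ne_zero _ t.ne_zero) hv⟩) fun s t H => ?_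
      have hv0 : v ≠ 0 := by
        rintro rfl
        have := hf.eval_smul 0 0
        rw [smul_zero, zero_pow (by omega), zero_mul] at this
        exact hv this
      exact Units.ext (smul_left_injective F hv0 (by simpa using H))
    rw [Nat.card_units, Nat.card_eq_fintype_card] at h1
    rw [pow_zero, mul_one, mul_comm]
    exact Nat.mul_le_mul (by omega) h1
  | succ n ih =>
    intro f hf hf0
    by_cases H : ∃ c : Fin (n + 1) → F,
        aeval (Fin.cons (linForm c) X : Fin (n + 2) → MvPolynomial (Fin (n + 1)) F) f = 0
    · obtain ⟨c, hc⟩ := H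
      exact le_nonzeroCount_of_aeval_cons_eq_zero hf hf0 hk1 hk hc
    · push Not at H
      have hf00 : eval 0 f = 0 := by
        have := hf.eval_smul 0 0
        rwa [smul_zero, zero_pow (by omega), zero_mul] at this
      have h1 := sum_nonzeroCount_le hf00
      rw [Finset.mul_sum] at h1
      have h2 := (Finset.sum_le_sum fun c _ => ih (f := aeval (Fin.cons (linForm c) X :
        Fin (n + 2) → MvPolynomial (Fin (n + 1)) F) f) (by
          simpa only [one_mul] using hf.aeval (n := 1) _ (fun i => by
            refine Fin.cases ?_ (fun j => ?_) i
            · simpa using isHomogeneous_linForm c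
            · simpa using isHomogeneous_X F j)) (H c)).trans h1
      rw [Finset.sum_const, Finset.card_univ, Fintype.card_fun, Fintype.card_fin, smul_eq_mul] at h2
      have h3 := Nat.le_of_mul_le_mul_left h2 (pow_pos Fintype.card_pos _)
      rw [pow_succ, ← mul_assoc, mul_comm]
      exact Nat.mul_le_mul_left _ h3


theorem card_subtype_eq_mul_card_projPts {F : Type*} [Field F] [Fintype F] {n : ℕ}
    {P : (Fin (n + 1) → F) → Prop} (hP : ∀ (t : F) v, t ≠ 0 → P v → P (t • v)) (hP0 : ¬ P 0) :
    Nat.card {v // P v} = (Fintype.card F - 1) * Nat.card {p : ProjPts F n // P p.1} := by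
  rw [← Nat.card_eq_fintype_card, ← Nat.card_units, ← Nat.card_prod]
  refine (Nat.card_eq_of_bijective
    (fun x : Fˣ × {p : ProjPts F n // P p.1} =>
      (⟨(x.1 : F) • x.2.1.1, hP _ _ x.1.ne_zero x.2.2⟩ : {v // P v})) ⟨?_, ?_⟩).symm
  · rintro ⟨s, ⟨v, i, hi, hvi⟩, hv⟩ ⟨t, ⟨w, j, hj, hwj⟩, hw⟩ H
    have hcoord (l) : (s : F) * v l = t * w l := congrFun (congrArg Subtype.val H) l
    obtain rfl : i = j := by
      rcases lt_trichotomy i j with h | h | h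
      · simpa [hvi, hj i h] using hcoord i
      · exact h
      · exact absurd (by simpa [hwj, hi j h] using hcoord j) t.ne_zero.symm
    obtain rfl : s = t := Units.ext (by simpa [hvi, hwj] using hcoord i)
    obtain rfl : v = w := _root_.funext fun l => mul_left_cancel₀ s.ne_zero (hcoord l)
    rfl
  · rintro ⟨v, hv⟩
    have hv0 : v ≠ 0 := fun h => hP0 (h ▸ hv)
    obtain ⟨i, hi, hmin⟩ := wellFounded_lt.has_min {i | v i ≠ 0} (Function.ne_iff.mp hv0)
    have hi : v i ≠ 0 := hi
    refine ⟨⟨Units.mk0 _ hi, ⟨(v i)⁻¹ • v, i, fun j hj => ?_, ?_⟩, hP _ _ (inv_ne_zero hi) hv⟩, ?_⟩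
    · have : v j = 0 := by
        by_contra h
        exact hmin j h hj
      simp [this]
    · simp [hi]
    · simp [smul_smul, hi]

theorem card_projPts_mul {F : Type*} [Field F] [Fintype F] {n : ℕ} :
    (Fintype.card F - 1) * Fintype.card (ProjPts F n) = Fintype.card F ^ (n + 1) - 1 := by
  classical
  have h := card_subtype_eq_mul_card_projPts (F := F) (n := n) (P := fun v => v ≠ 0)
    (fun t v ht hv => smul_ne_zero ht hv) (by simp)
  have h1 : Nat.card {p : ProjPts F n // p.1 ≠ 0} = Fintype.card (ProjPts F n) := by
    rw [← Nat.card_eq_fintype_card]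
    refine Nat.card_congr (Equiv.subtypeUnivEquiv ?_)
    rintro ⟨v, i, -, hi⟩ rfl
    simp at hi
  rw [← h1, ← h, Nat.card_eq_fintype_card, Fintype.card_subtype_compl]
  simp

open MvPolynomial in
theorem nonzeroCount_eq_mul_hammingNorm {F : Type*} [Field F] [Fintype F] [DecidableEq F]
    {n k : ℕ} (hk : 1 ≤ k) {f : MvPolynomial (Fin (n + 1)) F} (hf : f.IsHomogeneous k) :
    nonzeroCount f = (Fintype.card F - 1) * hammingNorm (evalOnPts F n f) := by
  rw [nonzeroCount, card_subtype_eq_mul_card_projPts (P := fun v => eval v f ≠ 0)]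
  · congr 1
    rw [Nat.card_eq_fintype_card, Fintype.card_subtype]
    rfl
  · intro t v ht hv
    rw [hf.eval_smul]
    exact mul_ne_zero (pow_ne_zero _ ht) hv
  · have := hf.eval_smul 0 0
    rw [smul_zero, zero_pow (by omega), zero_mul] at this
    simpa using this

/-- The minimum-weight form: a product of linear forms in the first two variables. -/
noncomputable def pencilForm {F : Type*} [Field F] (m : ℕ) (S : Finset F) :
    MvPolynomial (Fin (m + 2)) F :=
  ∏ a ∈ S, (MvPolynomial.X 0 - MvPolynomial.C a * MvPolynomial.X 1)

open MvPolynomial in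
theorem isHomogeneous_pencilForm {F : Type*} [Field F] (m : ℕ) (S : Finset F) :
    (pencilForm m S).IsHomogeneous S.card := by
  simpa [pencilForm] using IsHomogeneous.prod S _ (fun _ => 1) fun a _ =>
    (isHomogeneous_X F (0 : Fin (m + 2))).sub
      (by simpa using (isHomogeneous_C _ a).mul (isHomogeneous_X F (1 : Fin (m + 2))))

open MvPolynomial in
theorem nonzeroCount_pencilForm {F : Type*} [Field F] [Fintype F] (m : ℕ) {S : Finset F}
    (hS : S.Nonempty) : nonzeroCount (pencilForm m S) =
      (Fintype.card F - 1) * (Fintype.card F - S.card + 1) * Fintype.card F ^ m := by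
  classical
  have heval (v : Fin (m + 2) → F) :
      eval v (pencilForm m S) ≠ 0 ↔ v 0 ∉ S.image (· * v 1) := by
    rw [pencilForm, map_prod, Finset.prod_ne_zero_iff]
    simp [sub_ne_zero, eq_comm (b := v 0)]
  have e : {v : Fin (m + 2) → F // eval v (pencilForm m S) ≠ 0} ≃
      (Σ b : F, {x : F // x ∉ S.image (· * b)}) × (Fin m → F) :=
    { toFun := fun v => (⟨v.1 1, v.1 0, (heval v.1).mp v.2⟩, fun i => v.1 i.succ.succ)
      invFun := fun x => ⟨Fin.cons x.1.2.1 (Fin.cons x.1.1 x.2), (heval _).mpr x.1.2.2⟩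
      left_inv := by
        rintro ⟨v, hv⟩
        refine Subtype.ext (funext fun i => ?_)
        refine Fin.cases rfl (fun i => ?_) i
        exact Fin.cases rfl (fun i => rfl) i
      right_inv := fun x => rfl }
  have hcard (b : F) : Nat.card {x : F // x ∉ S.image (· * b)} =
      Fintype.card F - (S.image (· * b)).card := by
    rw [Nat.card_eq_fintype_card, Fintype.card_subtype_compl]
    simp only [Fintype.card_coe]
  rw [nonzeroCount, Nat.card_congr e, Nat.card_prod, Nat.card_sigma]
  simp only [hcard]
  rw [← Finset.add_sum_erase _ _ (Finset.mem_univ (0 : F)),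
    Finset.sum_congr rfl (g := fun _ => Fintype.card F - S.card) fun b hb => by
      rw [Finset.card_image_of_injective _ (mul_left_injective₀ (Finset.ne_of_mem_erase hb))]]
  simp only [mul_zero, Finset.image_const hS, Finset.card_singleton, Finset.sum_const,
    Finset.card_erase_of_mem (Finset.mem_univ _), Finset.card_univ, smul_eq_mul,
    Nat.card_eq_fintype_card, Fintype.card_fun, Fintype.card_fin]
  ring

open MvPolynomial in
theorem finrank_PRM (F : Type*) [Field F] [Fintype F] (n : ℕ) {k : ℕ} (hk1 : 1 ≤ k)
    (hk : k ≤ Fintype.card F) : Module.finrank F (PRM F n k) = (n + k).choose k := by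
  classical
  rw [← finrank_homogeneousSubmodule F n k, PRM]
  refine (LinearEquiv.ofBijective ((evalOnPts F n).submoduleMap
    (homogeneousSubmodule (Fin (n + 1)) F k))
    ⟨?_, LinearMap.submoduleMap_surjective _ _⟩).finrank_eq.symm
  rw [injective_iff_map_eq_zero]
  rintro ⟨f, hf⟩ h
  have h0 : evalOnPts F n f = 0 := congrArg Subtype.val h
  have hc := nonzeroCount_eq_mul_hammingNorm hk1 hf
  rw [h0, hammingNorm_zero, mul_zero] at hc
  by_contra hf0
  have := le_nonzeroCount_of_isHomogeneous hk1 hk hf (fun h => hf0 (Subtype.ext h))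
  rw [hc, mul_zero, Nat.le_zero] at this
  have hq := Fintype.one_lt_card (α := F)
  have : 0 < (Fintype.card F - 1) * (Fintype.card F - k + 1) * Fintype.card F ^ n :=
    Nat.mul_pos (Nat.mul_pos (by omega) (by omega)) (by positivity)
  omega

theorem stmt0 (q n : ℕ) (F : Type*) [Field F] [Fintype F] [DecidableEq F]
    (hq : Fintype.card F = q) (hn : 1 ≤ n) (k : ℕ) (hk1 : 1 ≤ k) (hkq : k < q) :
    Fintype.card (ProjPts F n) = (q ^ (n + 1) - 1) / (q - 1) ∧
    Module.finrank F (PRM F n k) = (n + k).choose k ∧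
    IsLeast {w : ℕ | ∃ c ∈ PRM F n k, c ≠ 0 ∧ hammingNorm c = w}
      ((q - k + 1) * q ^ (n - 1)) := by
  subst hq
  have hq1 : 0 < Fintype.card F - 1 := Nat.sub_pos_of_lt Fintype.one_lt_card
  obtain ⟨m, rfl⟩ := Nat.exists_eq_add_of_le' hn
  refine ⟨?_, finrank_PRM F _ hk1 hkq.le, ?_, ?_⟩
  · rw [← card_projPts_mul, Nat.mul_div_cancel_left _ hq1]
  · obtain ⟨S, -, hS⟩ := Finset.exists_subset_card_eq
      (show k ≤ (Finset.univ : Finset F).card from hkq.le)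
    have hf := isHomogeneous_pencilForm m S
    rw [hS] at hf
    have hw := nonzeroCount_eq_mul_hammingNorm hk1 hf
    rw [nonzeroCount_pencilForm m (Finset.card_pos.mp (by omega)), hS, mul_assoc] at hw
    have hw := Nat.eq_of_mul_eq_mul_left hq1 hw
    refine ⟨_, ⟨_, hf, rfl⟩, ?_, hw.symm⟩
    rw [← hammingNorm_pos_iff, ← hw]
    positivity
  · rintro w ⟨_, ⟨f, hf, rfl⟩, hc, rfl⟩
    have h := le_nonzeroCount_of_isHomogeneous hk1 hkq.le hf (by rintro rfl; simp at hc)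
    rw [nonzeroCount_eq_mul_hammingNorm hk1 hf, mul_assoc, mul_left_comm (Fintype.card F)] at h
    have h := Nat.le_of_mul_le_mul_left h hq1
    rw [pow_succ, ← mul_assoc, mul_comm] at h
    exact Nat.le_of_mul_le_mul_left h Fintype.card_pos
end

section
/- Let k be an integer with 1 ≤ k ≤ n(q-1). Then the projective Reed-Muller code C_{n,k}^q is self-dual if and only if q is odd, n is odd, and k = n(q-1)/2. -/
open scoped BigOperators

/-- The evaluation of the monomial with exponent vector `a` at the standard representatives. -/
def monoFn (F : Type*) [Field F] {n : ℕ} (a : Fin (n + 1) → ℕ) : ProjPts F n → F :=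
  fun p => ∏ i, p.1 i ^ a i

section

variable {F : Type*} [Field F] {n : ℕ}

theorem monoFn_add (a b : Fin (n + 1) → ℕ) : monoFn F (a + b) = monoFn F a * monoFn F b := by
  ext p
  simp [monoFn, pow_add, Finset.prod_mul_distrib]

/-- A natural-number vector of sum at least `s` dominates one of sum exactly `s`. -/
theorem exists_le_sum_eq {ι : Type*} [Fintype ι] (a : ι → ℕ) (s : ℕ)
    (h : s ≤ ∑ i, a i) : ∃ b c : ι → ℕ, a = b + c ∧ ∑ i, b i = s := by
  classical
  induction s with
  | zero => exact ⟨0, a, by simp, by simp⟩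
  | succ s ih =>
    obtain ⟨b, c, rfl, hb⟩ := ih (by omega)
    have hc : ∑ i, c i ≠ 0 := by
      simp only [Pi.add_apply, Finset.sum_add_distrib] at h
      omega
    obtain ⟨i, -, hi⟩ := Finset.exists_ne_zero_of_sum_ne_zero hc
    refine ⟨b + Pi.single i 1, c - Pi.single i 1, ?_, ?_⟩
    · ext j
      by_cases hj : j = i
      · subst hj
        simp
        omega
      · simp [hj]
    · simp [Finset.sum_add_distrib, hb]

theorem exists_smul_proj {v : Fin (n + 1) → F} (hv : v ≠ 0) :
    ∃ (u : Fˣ) (p : ProjPts F n), (u : F) • p.1 = v := by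
  classical
  have hex : ∃ i, v i ≠ 0 := Function.ne_iff.mp hv
  obtain ⟨i, hi, hmin⟩ := WellFounded.has_min (wellFounded_lt (α := Fin (n + 1)))
    {i | v i ≠ 0} hex
  refine ⟨Units.mk0 (v i) hi, ⟨(v i)⁻¹ • v, i, fun j hj => ?_, ?_⟩, ?_⟩
  · have : v j = 0 := by
      by_contra h
      exact hmin j h hj
    simp [this]
  · simpa using inv_mul_cancel₀ hi
  · simp [smul_smul, mul_inv_cancel₀ (show v i ≠ 0 from hi)]

theorem smul_proj_inj {u u' : F} (hu : u ≠ 0) (hu' : u' ≠ 0) {p p' : ProjPts F n}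
    (h : u • p.1 = u' • p'.1) : u = u' ∧ p = p' := by
  obtain ⟨p, i, hi, hi1⟩ := p
  obtain ⟨p', i', hi', hi1'⟩ := p'
  have hc : ∀ j, u * p j = u' * p' j := fun j => by simpa using congrFun h j
  have hii : i = i' := by
    rcases lt_trichotomy i i' with hlt | heq | hlt
    · have := hc i
      rw [hi1, hi' i hlt] at this
      simp_all
    · exact heq
    · have := hc i'
      rw [hi1', hi i' hlt] at this
      simp_all
  subst hii
  have huu : u = u' := by simpa [hi1, hi1'] using hc i
  subst huu
  refine ⟨rfl, Subtype.ext (funext fun j => mul_left_cancel₀ hu (hc j))⟩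

variable [Fintype F]

theorem monoFn_mem {a : Fin (n + 1) → ℕ} {k : ℕ} (h : ∑ i, a i = k) :
    monoFn F a ∈ PRM F n k := by
  refine ⟨MvPolynomial.monomial (Finsupp.equivFunOnFinite.symm a) 1, ?_, ?_⟩
  · apply MvPolynomial.isHomogeneous_monomial
    simpa [Finsupp.degree_eq_sum] using h
  · ext p
    simp [evalOnPts, monoFn, MvPolynomial.eval_monomial, Finsupp.prod_fintype]

theorem mem_PRM {k : ℕ} {y : ProjPts F n → F} (hy : y ∈ PRM F n k) :
    ∃ (s : Finset (Fin (n + 1) →₀ ℕ)) (c : (Fin (n + 1) →₀ ℕ) → F),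
      (∀ a ∈ s, ∑ i, a i = k) ∧ y = ∑ a ∈ s, c a • monoFn F a := by
  obtain ⟨f, hf, rfl⟩ := hy
  refine ⟨f.support, fun a => f.coeff a, fun a ha => ?_, ?_⟩
  · have := (MvPolynomial.mem_homogeneousSubmodule _ _).1 hf (MvPolynomial.mem_support_iff.1 ha)
    rw [← this]
    simp [Finsupp.weight_apply, Finsupp.sum_fintype]
  · ext p
    simp [evalOnPts, MvPolynomial.eval_eq', monoFn]

theorem PRM_le {k : ℕ} {D : Submodule F (ProjPts F n → F)}
    (h : ∀ a : Fin (n + 1) → ℕ, ∑ i, a i = k → monoFn F a ∈ D) : PRM F n k ≤ D := by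
  intro y hy
  obtain ⟨s, c, hs, rfl⟩ := mem_PRM hy
  exact D.sum_mem fun a ha => D.smul_mem _ (h a (hs a ha))

theorem mul_monoFn_mem {k l : ℕ} {y : ProjPts F n → F} (hy : y ∈ PRM F n k)
    {a : Fin (n + 1) → ℕ} (ha : ∑ i, a i = l) : y * monoFn F a ∈ PRM F n (k + l) := by
  obtain ⟨s, c, hs, rfl⟩ := mem_PRM hy
  rw [Finset.sum_mul]
  refine Submodule.sum_mem _ fun b hb => ?_
  rw [smul_mul_assoc, ← monoFn_add]
  refine Submodule.smul_mem _ _ (monoFn_mem ?_)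
  simp [Finset.sum_add_distrib, hs b hb, ha]

theorem pow_add_card_sub_one (x : F) {a : ℕ} (ha : a ≠ 0) :
    x ^ (a + (Fintype.card F - 1)) = x ^ a := by
  by_cases hx : x = 0
  · simp [hx, ha]
  · rw [pow_add, FiniteField.pow_card_sub_one_eq_one x hx, mul_one]

theorem monoFn_add_single (a : Fin (n + 1) → ℕ) {i : Fin (n + 1)} (hi : a i ≠ 0) :
    monoFn F (a + Pi.single i (Fintype.card F - 1)) = monoFn F a := by
  ext p
  refine Finset.prod_congr rfl fun j _ => ?_
  by_cases hj : j = i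
  · subst hj
    simpa using pow_add_card_sub_one (p.1 j) hi
  · simp [hj]

theorem PRM_le_add_card_sub_one {k : ℕ} (hk : k ≠ 0) :
    PRM F n k ≤ PRM F n (k + (Fintype.card F - 1)) := by
  refine PRM_le fun a ha => ?_
  obtain ⟨i, -, hi⟩ := Finset.exists_ne_zero_of_sum_ne_zero (ha.trans_ne hk)
  rw [← monoFn_add_single a hi]
  exact monoFn_mem (by simp [Finset.sum_add_distrib, ha])

theorem PRM_le_add_mul {k : ℕ} (hk : k ≠ 0) (j : ℕ) :
    PRM F n k ≤ PRM F n (k + j * (Fintype.card F - 1)) := by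
  induction j with
  | zero => simp
  | succ j ih =>
    refine ih.trans ((PRM_le_add_card_sub_one (by omega)).trans (le_of_eq ?_))
    congr 1
    ring

/-- Summing a scaling-invariant function over the projective points. -/
theorem sum_proj_eq (h : (Fin (n + 1) → F) → F) (hh : ∀ (u : Fˣ) v, h ((u : F) • v) = h v) :
    ∑ p : ProjPts F n, h p.1 = h 0 - ∑ v, h v := by
  classical
  have h1 : ∑ x : Fˣ × ProjPts F n, h ((x.1 : F) • x.2.1) =
      ∑ v ∈ Finset.univ.erase (0 : Fin (n + 1) → F), h v := by
    refine Finset.sum_bij (fun x _ => (x.1 : F) • x.2.1) ?_ ?_ ?_ ?_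
    · rintro ⟨u, p, i, hi, hi1⟩ -
      simp only [Finset.mem_erase, Finset.mem_univ, and_true]
      intro h0
      have := congrFun h0 i
      simp [hi1] at this
    · rintro ⟨u, p⟩ - ⟨u', p'⟩ - he
      obtain ⟨h1, h2⟩ := smul_proj_inj u.ne_zero u'.ne_zero he
      exact Prod.ext (Units.ext h1) h2
    · intro v hv
      obtain ⟨u, p, hup⟩ := exists_smul_proj (Finset.ne_of_mem_erase hv)
      exact ⟨(u, p), Finset.mem_univ _, hup⟩
    · intros
      rfl
  have h2 : ∑ x : Fˣ × ProjPts F n, h ((x.1 : F) • x.2.1) = -∑ p : ProjPts F n, h p.1 := by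
    simp only [hh, Fintype.sum_prod_type, Finset.sum_const, Finset.card_univ, Fintype.card_units,
      nsmul_eq_mul]
    rw [Nat.cast_sub Fintype.card_pos]
    simp
  have h3 := Finset.add_sum_erase Finset.univ h (Finset.mem_univ 0)
  rw [← h3, ← h1, h2]
  ring

theorem card_projPts_cast : (∑ _p : ProjPts F n, (1 : F)) = 1 := by
  rw [sum_proj_eq (fun _ => 1) (by simp)]
  simp

theorem sum_pow_eq_neg_one {a : ℕ} (ha : a ≠ 0) (hd : Fintype.card F - 1 ∣ a) :
    ∑ x : F, x ^ a = -1 := by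
  classical
  have : ∀ x : F, x ^ a = if x = 0 then 0 else 1 := by
    intro x
    split_ifs with hx
    · simp [hx, ha]
    · obtain ⟨c, rfl⟩ := hd
      rw [pow_mul, FiniteField.pow_card_sub_one_eq_one x hx, one_pow]
  simp only [this]
  rw [← Finset.add_sum_erase _ _ (Finset.mem_univ (0 : F)),
    Finset.sum_congr rfl (g := fun _ => (1 : F)) (fun x hx => by
      rw [if_neg (Finset.ne_of_mem_erase hx)])]
  simp [Finset.card_erase_of_mem, Nat.cast_sub Fintype.card_pos]

theorem ne_zero_and_dvd_of_sum_pow_ne_zero {a : ℕ} (h : ∑ x : F, x ^ a ≠ 0) :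
    a ≠ 0 ∧ Fintype.card F - 1 ∣ a := by
  classical
  have ha : a ≠ 0 := by
    rintro rfl
    simp at h
  refine ⟨ha, ?_⟩
  by_contra hd
  apply h
  have := FiniteField.sum_pow_units F a
  rw [if_neg hd] at this
  rw [← Finset.add_sum_erase _ _ (Finset.mem_univ (0 : F)), zero_pow ha, zero_add]
  refine Eq.trans (Finset.sum_bij (fun (u : Fˣ) _ => (u : F)) ?_ ?_ ?_ ?_).symm this
  · simp
  · intro _ _ _ _ h
    exact Units.ext h
  · intro x hx
    exact ⟨Units.mk0 x (Finset.ne_of_mem_erase hx), by simp, rfl⟩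
  · simp

theorem sum_monoFn {a : Fin (n + 1) → ℕ} (ha : ∑ i, a i ≠ 0)
    (hd : Fintype.card F - 1 ∣ ∑ i, a i) :
    ∑ p, monoFn F a p = -∏ i, ∑ x : F, x ^ a i := by
  classical
  have := sum_proj_eq (F := F) (n := n) (fun v => ∏ i, v i ^ a i) (by
    intro u v
    obtain ⟨c, hc⟩ := hd
    simp only [Pi.smul_apply, smul_eq_mul, mul_pow, Finset.prod_mul_distrib]
    rw [Finset.prod_pow_eq_pow_sum, hc, pow_mul,
      FiniteField.pow_card_sub_one_eq_one _ u.ne_zero, one_pow, one_mul])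
  simp only [monoFn]
  rw [this, Finset.prod_univ_sum]
  obtain ⟨i, -, hi⟩ := Finset.exists_ne_zero_of_sum_ne_zero ha
  rw [Finset.prod_eq_zero (Finset.mem_univ i) (by simp [hi])]
  simp

theorem sum_monoFn_ne_zero {a : Fin (n + 1) → ℕ} (ha : ∀ i, a i ≠ 0)
    (hd : ∀ i, Fintype.card F - 1 ∣ a i) : ∑ p, monoFn F a p ≠ 0 := by
  rw [sum_monoFn (fun h => ha 0 (Finset.sum_eq_zero_iff.1 h 0 (Finset.mem_univ _)))
    (Finset.dvd_sum fun i _ => hd i)]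
  simp [fun i => sum_pow_eq_neg_one (F := F) (ha i) (hd i)]

theorem card_sub_one_le_of_sum_monoFn_ne_zero {a : Fin (n + 1) → ℕ} (ha : ∑ i, a i ≠ 0)
    (hd : Fintype.card F - 1 ∣ ∑ i, a i) (h : ∑ p, monoFn F a p ≠ 0) (i : Fin (n + 1)) :
    Fintype.card F - 1 ≤ a i := by
  rw [sum_monoFn ha hd, neg_ne_zero, Finset.prod_ne_zero_iff] at h
  obtain ⟨h1, h2⟩ := ne_zero_and_dvd_of_sum_pow_ne_zero (h i (Finset.mem_univ i))
  exact Nat.le_of_dvd (by omega) h2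

theorem sum_monoFn_eq_zero {a : Fin (n + 1) → ℕ} (ha : ∑ i, a i ≠ 0)
    (hd : Fintype.card F - 1 ∣ ∑ i, a i) (hlt : ∑ i, a i < (n + 1) * (Fintype.card F - 1)) :
    ∑ p, monoFn F a p = 0 := by
  by_contra h
  have := Finset.sum_le_sum fun i (_ : i ∈ Finset.univ) =>
    card_sub_one_le_of_sum_monoFn_ne_zero ha hd h i
  simp at this
  omega

theorem mem_dualCode {C : Submodule F (ProjPts F n → F)} {y : ProjPts F n → F} :
    y ∈ dualCode C ↔ ∀ c ∈ C, ∑ p : ProjPts F n, y p * c p = 0 := Iff.rfl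

theorem mem_dualCode_PRM {k : ℕ} {y : ProjPts F n → F}
    (h : ∀ a : Fin (n + 1) → ℕ, ∑ i, a i = k → ∑ p, y p * monoFn F a p = 0) :
    y ∈ dualCode (PRM F n k) := by
  intro c hc
  obtain ⟨s, e, hs, rfl⟩ := mem_PRM hc
  simp only [Finset.sum_apply, Pi.smul_apply, smul_eq_mul, Finset.mul_sum]
  rw [Finset.sum_comm]
  refine Finset.sum_eq_zero fun a ha => ?_
  have := h a (hs a ha)
  simp only [mul_left_comm _ (e a), ← Finset.mul_sum, this, mul_zero]

theorem PRM_le_dualCode {k l : ℕ} (h0 : k + l ≠ 0) (hd : Fintype.card F - 1 ∣ k + l)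
    (hlt : k + l < (n + 1) * (Fintype.card F - 1)) :
    PRM F n k ≤ dualCode (PRM F n l) := by
  refine PRM_le fun a ha => mem_dualCode_PRM fun b hb => ?_
  have hab : ∑ i, (a + b) i = k + l := by simp [Finset.sum_add_distrib, ha, hb]
  have := sum_monoFn_eq_zero (F := F) (a := a + b) (by omega) (by rwa [hab]) (by omega)
  simpa [monoFn_add] using this

theorem one_mem_dualCode {k : ℕ} (h0 : k ≠ 0) (hd : Fintype.card F - 1 ∣ k)
    (hlt : k < (n + 1) * (Fintype.card F - 1)) :
    (1 : ProjPts F n → F) ∈ dualCode (PRM F n k) := by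
  refine mem_dualCode_PRM fun b hb => ?_
  simpa using sum_monoFn_eq_zero (F := F) (a := b) (by omega) (by rwa [hb]) (by omega)

/-- When `q - 1 ∤ d`, only the point with a single nonzero coordinate contributes to the sum of
the `d`-th powers of the last coordinates. -/
theorem sum_last_pow {d : ℕ} (hd : ¬ Fintype.card F - 1 ∣ d) :
    ∑ p : ProjPts F n, p.1 (Fin.last n) ^ d = 1 := by
  classical
  rw [← FiniteField.forall_pow_eq_one_iff F] at hd
  push Not at hd
  obtain ⟨c, hc⟩ := hd
  let e : ProjPts F n := ⟨Pi.single (Fin.last n) 1, Fin.last n,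
    fun j hj => by simp [hj.ne], by simp⟩
  have hstd : ∀ (u : Fˣ) (p : ProjPts F n), p ≠ e →
      IsStdRep (Function.update p.1 (Fin.last n) (u * p.1 (Fin.last n))) := by
    rintro u ⟨p, i, hi, hi1⟩ hp
    have hil : i ≠ Fin.last n := by
      rintro rfl
      apply hp
      ext j
      by_cases hj : j = Fin.last n
      · subst hj
        simp [e, hi1]
      · simp [e, hj, hi j (Fin.lt_last_iff_ne_last.2 hj)]
    refine ⟨i, fun j hj => ?_, by simp [hil, hi1]⟩
    have : j ≠ Fin.last n := (hj.trans_le (Fin.le_last i)).ne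
    simp [this, hi j hj]
  have hne : ∀ (u : Fˣ) (p : ProjPts F n) (hp : p ≠ e),
      (⟨_, hstd u p hp⟩ : ProjPts F n) ≠ e := by
    rintro u p hp h
    obtain ⟨i, hi, hi1⟩ := p.2
    have h' := fun j => congrFun (congrArg Subtype.val h) j
    by_cases hil : i = Fin.last n
    · subst hil
      apply hp
      ext j
      by_cases hj : j = Fin.last n
      · subst hj
        simp [e, hi1]
      · simp [e, hj, hi j (Fin.lt_last_iff_ne_last.2 hj)]
    · have := h' i
      simp [e, hil, hi1] at this
  have key : ∑ p ∈ Finset.univ.erase e, p.1 (Fin.last n) ^ d =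
      ∑ p ∈ Finset.univ.erase e, (c : F) ^ d * p.1 (Fin.last n) ^ d := by
    symm
    refine Finset.sum_bij'
      (fun p hp => ⟨_, hstd c p (Finset.ne_of_mem_erase hp)⟩)
      (fun p hp => ⟨_, hstd c⁻¹ p (Finset.ne_of_mem_erase hp)⟩) ?_ ?_ ?_ ?_ ?_
    · intro p hp
      simpa using hne c p (Finset.ne_of_mem_erase hp)
    · intro p hp
      simpa using hne c⁻¹ p (Finset.ne_of_mem_erase hp)
    · intro p hp
      ext j
      simp
    · intro p hp
      ext j
      simp
    · intro p hp
      simp [mul_pow]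
  rw [← Finset.mul_sum] at key
  have hc' : (c : F) ^ d - 1 ≠ 0 := fun h => hc (Units.ext (by simpa using sub_eq_zero.1 h))
  have hz : ∑ p ∈ Finset.univ.erase e, p.1 (Fin.last n) ^ d = 0 := by
    refine (mul_eq_zero.1 (?_ : ((c : F) ^ d - 1) * _ = 0)).resolve_left hc'
    rw [sub_mul, ← key]
    ring
  rw [← Finset.add_sum_erase _ _ (Finset.mem_univ e), hz]
  simp [e]

/-- Every function on the projective points comes from a homogeneous polynomial of each
sufficiently large degree. -/
theorem PRM_eq_top {k : ℕ} (hk : n * (Fintype.card F - 1) < k) : PRM F n k = ⊤ := by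
  classical
  have hQ : Fintype.card F - 1 ≠ 0 := by
    have := Fintype.one_lt_card (α := F)
    omega
  rw [eq_top_iff]
  intro y _
  have hind : ∀ p : ProjPts F n, (Pi.single p 1 : ProjPts F n → F) ∈ PRM F n k := by
    intro p
    obtain ⟨i, hi, hi1⟩ := p.2
    let f : MvPolynomial (Fin (n + 1)) F :=
      MvPolynomial.X i ^ (k - n * (Fintype.card F - 1)) *
        ∏ j ∈ Finset.univ.erase i, (MvPolynomial.X i ^ (Fintype.card F - 1) -
          (MvPolynomial.X j - MvPolynomial.C (p.1 j) * MvPolynomial.X i) ^ (Fintype.card F - 1))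
    have hf : f.IsHomogeneous k := by
      have h1 := (MvPolynomial.isHomogeneous_X F i).pow (k - n * (Fintype.card F - 1))
      have h2 := MvPolynomial.IsHomogeneous.prod (Finset.univ.erase i)
        (fun j => (MvPolynomial.X i ^ (Fintype.card F - 1) -
          (MvPolynomial.X j - MvPolynomial.C (p.1 j) * MvPolynomial.X i) ^
            (Fintype.card F - 1) : MvPolynomial (Fin (n + 1)) F))
        (fun _ => Fintype.card F - 1) (fun j _ => by
          have h3 := (MvPolynomial.isHomogeneous_X F i).pow (Fintype.card F - 1)
          have h4 := ((MvPolynomial.isHomogeneous_X F j).sub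
            ((MvPolynomial.isHomogeneous_X F i).C_mul (p.1 j))).pow (Fintype.card F - 1)
          simpa using h3.sub h4)
      have h5 := h1.mul h2
      convert h5 using 1
      simp [Finset.card_erase_of_mem]
      omega
    refine ⟨f, hf, ?_⟩
    ext v
    change MvPolynomial.eval v.1 f = _
    simp only [f, map_mul, map_pow, map_prod, map_sub, MvPolynomial.eval_X, MvPolynomial.eval_C]
    by_cases hv : v = p
    · subst hv
      simp [hi1, hQ]
    · rw [Pi.single_eq_of_ne hv]
      by_cases hvi : v.1 i = 0
      · rw [hvi, zero_pow (by omega), zero_mul]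
      · have : ∃ j, v.1 j ≠ v.1 i * p.1 j := by
          by_contra! hall
          apply hv
          refine (smul_proj_inj (u := 1) one_ne_zero hvi ?_).2
          ext j
          simpa using hall j
        obtain ⟨j, hj⟩ := this
        have hji : j ≠ i := by
          rintro rfl
          simp [hi1] at hj
        rw [Finset.prod_eq_zero (Finset.mem_erase.2 ⟨hji, Finset.mem_univ j⟩), mul_zero]
        rw [FiniteField.pow_card_sub_one_eq_one _ hvi, FiniteField.pow_card_sub_one_eq_one,
          sub_self]
        rw [mul_comm]
        exact sub_ne_zero.2 hj
  have : y = ∑ p, y p • (Pi.single p 1 : ProjPts F n → F) := by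
    ext v
    simp [Finset.sum_apply, Pi.single_apply]
  rw [this]
  exact Submodule.sum_mem _ fun p _ => Submodule.smul_mem _ _ (hind p)

theorem PRM_add_le_of_le {k l : ℕ} (h : PRM F n (k + l) ≤ PRM F n k) (j : ℕ) :
    PRM F n (k + j * l) ≤ PRM F n k := by
  induction j with
  | zero => simp
  | succ j ih =>
    refine PRM_le fun a ha => ?_
    obtain ⟨b, c, rfl, hb⟩ := exists_le_sum_eq a (k + j * l) (by rw [ha]; gcongr; omega)
    rw [monoFn_add]
    refine h (mul_monoFn_mem (ih (monoFn_mem hb)) ?_)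
    simp only [Pi.add_apply, Finset.sum_add_distrib, hb] at ha
    linarith

/-- A degree `k + (j + 1) (q - 1)` codeword orthogonal to `PRM F n k` already has
degree `k + j (q - 1)`. -/
theorem mem_PRM_of_mem_dualCode {k : ℕ} (hd : ¬ Fintype.card F - 1 ∣ k)
    (h2k : 2 * k = n * (Fintype.card F - 1)) {j : ℕ} {y : ProjPts F n → F}
    (hy : y ∈ PRM F n (k + (j + 1) * (Fintype.card F - 1)))
    (hy' : y ∈ dualCode (PRM F n k)) : y ∈ PRM F n (k + j * (Fintype.card F - 1)) := by
  classical
  set Q := Fintype.card F - 1 with hQ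
  obtain ⟨s, c, hs, rfl⟩ := mem_PRM hy
  refine Submodule.sum_mem _ fun a ha => ?_
  by_cases hred : ∀ i, a i ≤ Q
  · suffices c a = 0 by simp [this]
    let b : Fin (n + 1) → ℕ := fun i => Q - a i
    have hab : ∀ i, a i + b i = Q := fun i => by
      have := hred i
      simp only [b]
      omega
    have hsum : ∑ i, a i + ∑ i, b i = (n + 1) * Q := by
      rw [← Finset.sum_add_distrib]
      simp [hab]
    rw [hs a ha] at hsum
    have hbk : ∑ i, b i + j * Q = k := by linarith
    have hb0 : ∑ i, b i ≠ 0 := by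
      intro h0
      apply hd
      rw [← hbk, h0, zero_add]
      exact Dvd.intro_left j rfl
    have hbmem : monoFn F b ∈ PRM F n k := by
      have := PRM_le_add_mul hb0 j (monoFn_mem (F := F) (a := b) rfl)
      rwa [hbk] at this
    have horth := hy' _ hbmem
    simp only [Finset.sum_apply, Pi.smul_apply, smul_eq_mul, Finset.sum_mul] at horth
    rw [Finset.sum_comm, Finset.sum_eq_single_of_mem a ha] at horth
    · simp only [mul_assoc, ← Finset.mul_sum] at horth
      refine (mul_eq_zero.1 horth).resolve_right ?_
      have := sum_monoFn_ne_zero (F := F) (a := ⇑a + b) (fun i => by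
        have := Fintype.one_lt_card (α := F)
        rw [Pi.add_apply, hab]
        omega) (fun i => by rw [Pi.add_apply, hab])
      simpa [monoFn_add] using this
    · intro a' ha' hne
      simp only [mul_assoc, ← Finset.mul_sum]
      refine mul_eq_zero_of_right _ ?_
      by_contra h
      have hs' : ∑ i, (⇑a' + b) i = (n + 1) * Q := by
        simp only [Pi.add_apply, Finset.sum_add_distrib, hs a' ha', hsum]
      have hle := card_sub_one_le_of_sum_monoFn_ne_zero (F := F) (a := ⇑a' + b)
        (by simp only [Pi.add_apply, Finset.sum_add_distrib]; omega)
        (by rw [hs']; exact Dvd.intro_left _ rfl)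
        (by simpa [monoFn_add] using h)
      apply hne
      ext i
      have heq := (Finset.sum_eq_sum_iff_of_le (s := Finset.univ) (fun i _ => hle i)).1
        (by rw [hs']; simp [hQ]) i (Finset.mem_univ i)
      have := hab i
      simp only [Pi.add_apply] at heq
      omega
  · push Not at hred
    obtain ⟨i, hi⟩ := hred
    have hsplit : (⇑a : Fin (n + 1) → ℕ) = (⇑a - Pi.single i Q) + Pi.single i Q := by
      ext l
      by_cases hl : l = i
      · subst hl
        simp
        omega
      · simp [hl]
    refine Submodule.smul_mem _ _ ?_
    have hsum := hs a ha
    rw [hsplit] at hsum ⊢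
    rw [monoFn_add_single _ (by simp; omega)]
    refine monoFn_mem ?_
    simp only [Pi.add_apply, Finset.sum_add_distrib, Finset.sum_pi_single', Finset.mem_univ,
      if_true] at hsum
    linarith

theorem dualCode_PRM_le {k : ℕ} (hk : k ≠ 0) (hd : ¬ Fintype.card F - 1 ∣ k)
    (h2k : 2 * k = n * (Fintype.card F - 1)) : dualCode (PRM F n k) ≤ PRM F n k := by
  intro y hy
  have hdesc : ∀ j, y ∈ PRM F n (k + j * (Fintype.card F - 1)) → y ∈ PRM F n k := by
    intro j
    induction j with
    | zero => simp
    | succ j ih => exact fun h => ih (mem_PRM_of_mem_dualCode hd h2k h hy)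
  apply hdesc n
  rw [PRM_eq_top (by omega)]
  trivial

/-- A self-orthogonal code cannot contain the two factors of a monomial all of whose exponents
are positive multiples of `q - 1`. -/
theorem not_mem_dualCode_of_add {C : Submodule F (ProjPts F n → F)} {b c : Fin (n + 1) → ℕ}
    (h0 : ∀ i, (b + c) i ≠ 0) (hd : ∀ i, Fintype.card F - 1 ∣ (b + c) i)
    (hc : monoFn F c ∈ C) : monoFn F b ∉ dualCode C := fun hb =>
  sum_monoFn_ne_zero (F := F) h0 hd (by simpa [monoFn_add] using hb _ hc)

theorem dvd_two_mul_of_selfOrthogonal {k : ℕ}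
    (h : PRM F n k ≤ dualCode (PRM F n k)) : Fintype.card F - 1 ∣ 2 * k := by
  classical
  by_contra hd
  have hm : monoFn F (n := n) (Pi.single (Fin.last n) k) ∈ PRM F n k := monoFn_mem (by simp)
  have h0 := h hm _ hm
  have hval : ∀ p : ProjPts F n,
      monoFn F (Pi.single (Fin.last n) k) p = p.1 (Fin.last n) ^ k := by
    intro p
    rw [monoFn, Finset.prod_eq_single (Fin.last n)]
    · simp
    · intro j _ hj
      simp [hj]
    · simp
  simp only [hval, ← pow_add, ← two_mul, sum_last_pow hd, one_ne_zero] at h0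

theorem two_mul_eq_of_selfDual {k : ℕ}
    (h : PRM F n k = dualCode (PRM F n k)) : 2 * k = n * (Fintype.card F - 1) := by
  classical
  obtain ⟨t, ht⟩ := dvd_two_mul_of_selfOrthogonal h.le
  have hQ : 0 < Fintype.card F - 1 := by
    have := Fintype.one_lt_card (α := F)
    omega
  rw [mul_comm _ t] at ht
  set Q := Fintype.card F - 1 with hQdef
  rcases lt_trichotomy t n with hlt | rfl | hgt
  · exfalso
    have hstep : PRM F n (k + Q) ≤ PRM F n k := by
      have hsum : k + Q + k = (t + 1) * Q := by linarith
      refine (PRM_le_dualCode (l := k) (by omega) ?_ ?_).trans h.ge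
      · rw [hsum]
        exact Dvd.intro_left _ rfl
      · rw [hsum]
        exact Nat.mul_lt_mul_of_pos_right (by omega) hQ
    obtain ⟨j, rfl⟩ := Nat.exists_eq_add_of_lt hlt
    have hle : k ≤ ∑ _i : Fin (t + j + 1 + 1), Q := by
      simp
      nlinarith
    obtain ⟨b, c, hbc, hb⟩ := exists_le_sum_eq (fun _ : Fin (t + j + 1 + 1) => Q) k hle
    have hc : ∑ i, c i = k + (j + 2) * Q := by
      have := congrArg (fun f => ∑ i, f i) hbc
      simp [Finset.sum_add_distrib, hb] at this
      linarith
    refine not_mem_dualCode_of_add (F := F) (b := b) (c := c) ?_ ?_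
      (PRM_add_le_of_le hstep (j + 2) (monoFn_mem hc)) (h.le (monoFn_mem hb))
    · rw [← hbc]
      exact fun _ => hQ.ne'
    · rw [← hbc]
      exact fun _ => dvd_rfl
  · exact ht
  · exfalso
    obtain ⟨j, rfl⟩ := Nat.exists_eq_add_of_lt hgt
    let a : Fin (n + 1) → ℕ := (fun _ => Q) + Pi.single 0 (j * Q)
    have ha : ∑ i, a i = 2 * k := by
      simp [a, Finset.sum_add_distrib]
      linarith
    obtain ⟨b, c, hbc, hb⟩ := exists_le_sum_eq a k (by omega)
    have hc : ∑ i, c i = k := by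
      have := congrArg (fun f => ∑ i, f i) hbc
      simp [Finset.sum_add_distrib, hb, ha] at this
      omega
    refine not_mem_dualCode_of_add (F := F) (b := b) (c := c) ?_ ?_
      (monoFn_mem hc) (h.le (monoFn_mem hb))
    · rw [← hbc]
      intro i
      simp only [a, Pi.add_apply]
      omega
    · rw [← hbc]
      intro i
      refine dvd_add dvd_rfl ?_
      by_cases hi : i = 0
      · subst hi
        rw [Pi.single_eq_same]
        exact Dvd.intro_left j rfl
      · simp [hi]

theorem not_dvd_of_selfDual {k : ℕ} (hk : k ≠ 0) (hlt : k < (n + 1) * (Fintype.card F - 1))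
    (h : PRM F n k = dualCode (PRM F n k)) : ¬ Fintype.card F - 1 ∣ k := by
  intro hd
  have h1 := one_mem_dualCode (F := F) (n := n) hk hd hlt
  have := h1 1 (h.ge h1)
  simp only [Pi.one_apply, mul_one, card_projPts_cast, one_ne_zero] at this

end

theorem stmt8 (q n : ℕ) (F : Type*) [Field F] [Fintype F] [DecidableEq F]
    (hq : Fintype.card F = q) (hn : 1 ≤ n) (k : ℕ) (hk1 : 1 ≤ k) (hk2 : k ≤ n * (q - 1)) :
    PRM F n k = dualCode (PRM F n k) ↔ Odd q ∧ Odd n ∧ 2 * k = n * (q - 1) := by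
  subst hq
  have hq1 := Fintype.one_lt_card (α := F)
  have hlt : k < (n + 1) * (Fintype.card F - 1) := by
    rw [add_mul]
    omega
  constructor
  · intro h
    have h2k := two_mul_eq_of_selfDual h
    have hnd := not_dvd_of_selfDual (by omega) hlt h
    refine ⟨?_, ?_, h2k⟩
    · by_contra hodd
      have hcop : Nat.Coprime (Fintype.card F - 1) 2 := by
        rw [Nat.coprime_two_right]
        rw [Nat.not_odd_iff_even] at hodd
        exact Nat.Even.sub_odd (by omega) hodd odd_one
      exact hnd (hcop.dvd_of_dvd_mul_left (h2k ▸ Dvd.intro_left n rfl))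
    · by_contra hodd
      rw [Nat.not_odd_iff_even] at hodd
      obtain ⟨m, rfl⟩ := hodd
      exact hnd ⟨m, by linarith⟩
  · rintro ⟨-, hnodd, h2k⟩
    refine le_antisymm ?_ ?_
    · refine PRM_le_dualCode (by omega) ?_ ?_
      · rw [← two_mul, h2k]
        exact Dvd.intro_left n rfl
      · rw [← two_mul, h2k]
        exact Nat.mul_lt_mul_of_pos_right (by omega) (by omega)
    · refine dualCode_PRM_le (by omega) ?_ h2k
      rintro ⟨m, rfl⟩
      have : n = 2 * m := Nat.eq_of_mul_eq_mul_right (show 0 < Fintype.card F - 1 by omega)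
        (by linarith)
      exact (Nat.not_odd_iff_even.2 ⟨m, by omega⟩) hnodd
end

section
/- Suppose n(q-1)/2 ≤ k ≤ n(q-1), 2k ≡ 0 (mod q-1), and k is not congruent to 0 modulo q-1. Then the dual code (C_{n,k}^q)^⊥ is self-orthogonal. Equivalently, for any odd positive integer r with n ≤ r < 2n, the code (C_{n, r(q-1)/2}^q)^⊥ is self-orthogonal. -/
open scoped BigOperators

/-- The indicator of the diagonal of a finite field as a polynomial in two variables. -/
theorem one_sub_sum_pow_mul_pow_eq_ite {F : Type*} [Field F] [Fintype F] [DecidableEq F]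
    (v w : F) :
    1 - ∑ j : Fin (Fintype.card F), v ^ (j : ℕ) * w ^ (Fintype.card F - 1 - j) =
      if v = w then 1 else 0 := by
  rw [Fin.sum_univ_eq_sum_range (fun j => v ^ j * w ^ (Fintype.card F - 1 - j))]
  split_ifs with h
  · subst h
    have hpow : ∀ j ∈ Finset.range (Fintype.card F),
        v ^ j * v ^ (Fintype.card F - 1 - j) = v ^ (Fintype.card F - 1) := by
      intro j hj
      rw [← pow_add]
      congr 1
      have := Finset.mem_range.mp hj
      omega
    rw [Finset.sum_congr rfl hpow]
    simp
  · have hgeom := (Commute.all v w).geom_sum₂_mul (Fintype.card F)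
    rw [FiniteField.pow_card, FiniteField.pow_card] at hgeom
    rw [mul_right_cancel₀ (sub_ne_zero.mpr h) (hgeom.trans (one_mul _).symm), sub_self]

/-- The exponent of the first variable in the terms of the diagonal indicator. -/
def diagFstExp {q : ℕ} : Option (Fin q) → ℕ
  | none => 0
  | some j => j

/-- The exponent of the second variable in the terms of the diagonal indicator. -/
def diagSndExp {q : ℕ} : Option (Fin q) → ℕ
  | none => 0
  | some j => q - 1 - j

/-- The coefficients of the terms of the diagonal indicator. -/
def diagCoeff (F : Type*) [Field F] {q : ℕ} : Option (Fin q) → F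
  | none => 1
  | some _ => -1

theorem exists_diagFstExp_add_diagSndExp {q : ℕ} (t : Option (Fin q)) :
    ∃ m ≤ 1, diagFstExp t + diagSndExp t = (q - 1) * m := by
  cases t with
  | none => exact ⟨0, zero_le_one, rfl⟩
  | some j =>
    refine ⟨1, le_rfl, ?_⟩
    simp only [diagFstExp, diagSndExp]
    omega

theorem sum_diagCoeff_mul_eq_ite {F : Type*} [Field F] [Fintype F] [DecidableEq F] (v w : F) :
    ∑ t : Option (Fin (Fintype.card F)), diagCoeff F t * v ^ diagFstExp t * w ^ diagSndExp t =
      if v = w then 1 else 0 := by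
  rw [← one_sub_sum_pow_mul_pow_eq_ite, Fintype.sum_option]
  simp [diagCoeff, diagFstExp, diagSndExp, sub_eq_add_neg]

theorem IsStdRep.eq_one_of_smul {F : Type*} [Field F] {n : ℕ} {v w : Fin (n + 1) → F}
    (hv : IsStdRep v) (hw : IsStdRep w) (u : Fˣ) (h : ∀ i, (u : F) * v i = w i) : u = 1 := by
  obtain ⟨i, hi, hi1⟩ := hv
  obtain ⟨j, hj, hj1⟩ := hw
  have hij : i = j := by
    rcases lt_trichotomy i j with hlt | heq | hgt
    · have := h i
      rw [hj i hlt, hi1, mul_one] at this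
      exact absurd this u.ne_zero
    · exact heq
    · have := h j
      rw [hi j hgt, hj1, mul_zero] at this
      exact absurd this zero_ne_one
  subst hij
  have := h i
  rw [hi1, hj1, mul_one] at this
  exact Units.ext this

theorem sum_units_pow_mul_prod_ite {F : Type*} [Field F] [Fintype F] [DecidableEq F] {n : ℕ}
    (k : ℕ) (p r : ProjPts F n) :
    ∑ u : Fˣ, (u : F) ^ k * ∏ i, (if (u : F) * p.1 i = r.1 i then (1 : F) else 0) =
      if p = r then 1 else 0 := by
  simp only [Finset.prod_ite_zero, Finset.prod_const_one, Finset.mem_univ, true_imp_iff]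
  rw [Finset.sum_eq_single 1]
  · have : (∀ i, ((1 : Fˣ) : F) * p.1 i = r.1 i) ↔ p = r := by
      simp [Subtype.ext_iff, funext_iff]
    simp only [this]
    simp
  · intro u _ hu
    rw [if_neg fun h => hu (p.2.eq_one_of_smul r.2 u h), mul_zero]
  · simp

/-- Expansion of the diagonal indicator of the projective points into products of monomials. -/
theorem sum_monomials_eq_ite {F : Type*} [Field F] [Fintype F] [DecidableEq F] {n : ℕ}
    (k : ℕ) (p r : ProjPts F n) :
    ∑ t : Fin (n + 1) → Option (Fin (Fintype.card F)),
      (∏ i, diagCoeff F (t i)) * (∑ u : Fˣ, (u : F) ^ (k + ∑ i, diagFstExp (t i))) *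
        ((∏ i, p.1 i ^ diagFstExp (t i)) * ∏ i, r.1 i ^ diagSndExp (t i)) =
      if p = r then 1 else 0 := by
  rw [← sum_units_pow_mul_prod_ite k p r]
  simp only [← sum_diagCoeff_mul_eq_ite, Finset.prod_univ_sum, Fintype.piFinset_univ,
    Finset.mul_sum, Finset.sum_mul]
  rw [Finset.sum_comm]
  refine Finset.sum_congr rfl fun u _ => Finset.sum_congr rfl fun t _ => ?_
  simp only [mul_pow, Finset.prod_mul_distrib, Finset.prod_pow_eq_pow_sum, pow_add]
  ring

/-- Nonconstant monomials of degree at most `k` and congruent to `k` modulo `q - 1` evaluate to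
codewords of `PRM F n k`. -/
theorem prod_pow_mem_PRM {F : Type*} [Field F] [Fintype F] {n k : ℕ} (d : Fin (n + 1) → ℕ)
    (hd0 : ∑ i, d i ≠ 0) (hdk : ∑ i, d i ≤ k) (hdvd : (Fintype.card F - 1) ∣ k - ∑ i, d i) :
    (fun p : ProjPts F n => ∏ i, p.1 i ^ d i) ∈ PRM F n k := by
  obtain ⟨i₀, -, hi₀⟩ := Finset.exists_ne_zero_of_sum_ne_zero hd0
  refine ⟨(∏ i, MvPolynomial.X i ^ d i) * MvPolynomial.X i₀ ^ (k - ∑ i, d i), ?_, ?_⟩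
  · have h := (MvPolynomial.IsHomogeneous.prod (R := F) Finset.univ
      (fun i : Fin (n + 1) => MvPolynomial.X i ^ d i) d
      fun i _ => MvPolynomial.isHomogeneous_X_pow i (d i)).mul
        (MvPolynomial.isHomogeneous_X_pow i₀ (k - ∑ i, d i))
    rw [Nat.add_sub_cancel' hdk] at h
    exact h
  · ext p
    simp only [evalOnPts, LinearMap.coe_mk, AddHom.coe_mk, map_mul, map_prod, map_pow,
      MvPolynomial.eval_X]
    by_cases hp : p.1 i₀ = 0
    · rw [Finset.prod_eq_zero (Finset.mem_univ i₀) (by rw [hp, zero_pow hi₀]), zero_mul]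
    · obtain ⟨m, hm⟩ := hdvd
      rw [hm, pow_mul, FiniteField.pow_card_sub_one_eq_one _ hp, one_pow, mul_one]

/-- If the degrees `A`, `B` sum to at most `n + 1` multiples of `N` and `A ≡ -k` modulo `N`, then
one of them is nonzero, at most `k` and congruent to `k`. -/
theorem degree_dichotomy {N n k A B m : ℕ} (hnk : n * N ≤ 2 * k) (h2k : N ∣ 2 * k)
    (hk : ¬ N ∣ k) (hA : N ∣ k + A) (hm : m ≤ n + 1) (hAB : A + B = N * m) :
    (A ≠ 0 ∧ A ≤ k ∧ N ∣ k - A) ∨ (B ≠ 0 ∧ B ≤ k ∧ N ∣ k - B) := by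
  have hA' : ¬ N ∣ A := fun h => hk ((Nat.dvd_add_left h).mp hA)
  rcases le_or_gt A k with hAk | hAk
  · refine Or.inl ⟨fun h => hA' (h ▸ dvd_zero N), hAk, ?_⟩
    have : k - A = 2 * k - (k + A) := by omega
    exact this ▸ Nat.dvd_sub h2k hA
  · refine Or.inr ⟨?_, ?_, ?_⟩
    · rintro rfl
      exact hA' ⟨m, hAB⟩
    · obtain ⟨c, hc⟩ := hA
      have hnc : n < c := by
        by_contra! hcn
        have := Nat.mul_le_mul_left N hcn
        rw [mul_comm N n] at this
        omega
      have : N * m ≤ N * c := Nat.mul_le_mul_left N (by omega)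
      omega
    · have : k - B = k + A - N * m := by omega
      exact this ▸ Nat.dvd_sub hA (dvd_mul_right N m)

theorem stmt12 (q n : ℕ) (F : Type*) [Field F] [Fintype F] [DecidableEq F]
    (hq : Fintype.card F = q) (hn : 1 ≤ n) (k : ℕ) (hk1 : n * (q - 1) ≤ 2 * k) (hk2 : k ≤ n * (q - 1))
    (hkd : (q - 1) ∣ 2 * k) (hkd' : ¬ (q - 1) ∣ k) :
    dualCode (PRM F n k) ≤ dualCode (dualCode (PRM F n k)) := by
  subst hq
  intro y hy z hz
  have hexp : ∑ p, y p * z p =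
      ∑ t : Fin (n + 1) → Option (Fin (Fintype.card F)),
        (∏ i, diagCoeff F (t i)) * (∑ u : Fˣ, (u : F) ^ (k + ∑ i, diagFstExp (t i))) *
          ((∑ p : ProjPts F n, y p * ∏ i, p.1 i ^ diagFstExp (t i)) *
            ∑ r : ProjPts F n, z r * ∏ i, r.1 i ^ diagSndExp (t i)) := by
    calc ∑ p, y p * z p = ∑ p, ∑ r, y p * z r * (if p = r then 1 else 0) := by simp
      _ = _ := by
        simp only [← sum_monomials_eq_ite k,
          Finset.sum_mul_sum (Finset.univ : Finset (ProjPts F n)),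
          Finset.mul_sum (Finset.univ : Finset (ProjPts F n)),
          Finset.mul_sum (Finset.univ : Finset (Fin (n + 1) → Option (Fin (Fintype.card F))))]
        conv_rhs => rw [Finset.sum_comm]
        refine Finset.sum_congr rfl fun p _ => ?_
        conv_rhs => rw [Finset.sum_comm]
        exact Finset.sum_congr rfl fun r _ => Finset.sum_congr rfl fun t _ => by ring
  rw [hexp]
  refine Finset.sum_eq_zero fun t _ => ?_
  by_cases hA : (Fintype.card F - 1) ∣ k + ∑ i, diagFstExp (t i)
  · choose m hm1 hm using fun i => exists_diagFstExp_add_diagSndExp (t i)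
    have hmn : ∑ i, m i ≤ n + 1 := by
      simpa using Finset.sum_le_card_nsmul Finset.univ m 1 fun i _ => hm1 i
    have hAB : ∑ i, diagFstExp (t i) + ∑ i, diagSndExp (t i) =
        (Fintype.card F - 1) * ∑ i, m i := by
      rw [← Finset.sum_add_distrib, Finset.mul_sum]
      exact Finset.sum_congr rfl fun i _ => hm i
    rcases degree_dichotomy hk1 hkd hkd' hA hmn hAB with ⟨h0, hle, hdvd⟩ | ⟨h0, hle, hdvd⟩
    · rw [hy _ (prod_pow_mem_PRM (fun i => diagFstExp (t i)) h0 hle hdvd), zero_mul, mul_zero]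
    · rw [hz _ (prod_pow_mem_PRM (fun i => diagSndExp (t i)) h0 hle hdvd), mul_zero, mul_zero]
  · rw [FiniteField.sum_pow_units, if_neg hA, mul_zero, zero_mul]
end
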